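/- Let G be a simple connected graph on n vertices and suppose A ∈ S(G) is strictly supported on G and has simple eigenvalues λ_1 < … < λ_n with eigenvectors φ_1, …, φ_n (which may have zero entries). Then there exist sign vectors ξ_1, …, ξ_n ∈ {−1, +1}^n with ξ_k(i) = sign(φ_k(i)) whenever φ_k(i) ≠ 0, such that β(G) ≤ Σ_{k=1}^{n} [ν(A,ξ_k) − (k−1)] ≤ n·β(G) − β(G), where ν(A,ξ) = #{(i,j) : i<j, A_{ij}·ξ(i)·ξ(j) > 0}. -/

import Mathlib

open Matrix

/-- A matrix is supported on a simple graph `G` if its off-diagonal entries vanish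
outside the edges of `G`. -/
def SupportedOn {V : Type*} (G : SimpleGraph V) (A : Matrix V V ℝ) : Prop :=
  ∀ i j, i ≠ j → ¬ G.Adj i j → A i j = 0

/-- The nodal count of a vector `φ` with respect to a matrix `A`. -/
noncomputable def nodalCount {n : ℕ} (A : Matrix (Fin n) (Fin n) ℝ) (φ : Fin n → ℝ) : ℕ :=
  Nat.card {p : Fin n × Fin n // p.1 < p.2 ∧ 0 < A p.1 p.2 * φ p.1 * φ p.2}

/-- The first Betti number of a graph on `n` vertices: `|E(G)| - (n - 1)`. -/
noncomputable def betti {n : ℕ} (G : SimpleGraph (Fin n)) : ℕ :=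
  Nat.card G.edgeSet - (n - 1)

/-- The pairs `i < j` at which `A` does not vanish. -/
abbrev UpperSupport {n : ℕ} (A : Matrix (Fin n) (Fin n) ℝ) : Type :=
  {p : Fin n × Fin n // p.1 < p.2 ∧ A p.1 p.2 ≠ 0}

lemma two_mul_sum_upperSupport {n : ℕ} (A : Matrix (Fin n) (Fin n) ℝ) (f : Fin n → Fin n → ℝ)
    (hsymm : ∀ i j, f i j = f j i) (hdiag : ∀ i, f i i = 0)
    (hzero : ∀ i j, A i j = 0 → f i j = 0) :
    2 * ∑ p : UpperSupport A, f p.1.1 p.1.2 = ∑ i, ∑ j, f i j := by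
  have h1 : ∑ p : UpperSupport A, f p.1.1 p.1.2
      = ∑ p : Fin n × Fin n, if p.1 < p.2 then f p.1 p.2 else 0 := by
    rw [← Finset.sum_filter, ← Finset.sum_subtype
      (Finset.univ.filter fun p : Fin n × Fin n => p.1 < p.2 ∧ A p.1 p.2 ≠ 0)
      (by simp) (fun p => f p.1 p.2)]
    refine Finset.sum_subset (fun p => by simp +contextual) fun p hp hp' => hzero _ _ ?_
    simp only [Finset.mem_filter_univ] at hp hp'
    tauto
  have h2 : ∑ p : Fin n × Fin n, (if p.1 < p.2 then f p.1 p.2 else 0)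
      = ∑ p : Fin n × Fin n, if p.2 < p.1 then f p.1 p.2 else 0 := by
    refine Fintype.sum_equiv (Equiv.prodComm _ _) _ _ fun p => ?_
    by_cases h : p.1 < p.2 <;> simp [h, hsymm p.1 p.2]
  rw [h1, two_mul, ← Fintype.sum_prod_type']
  nth_rewrite 2 [h2]
  rw [← Finset.sum_add_distrib]
  refine Finset.sum_congr rfl fun p _ => ?_
  rcases lt_trichotomy p.1 p.2 with h | h | h
  · simp [h, h.not_gt]
  · simp [h, hdiag]
  · simp [h, h.not_gt]

/-- The edge weights `-A i j * φ i * φ j` pull back to the form of `A - lam` under `x ↦ d (x / φ)`. -/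
lemma sum_weight_sq {n : ℕ} {A : Matrix (Fin n) (Fin n) ℝ} (hA : A.IsSymm) {μ : ℝ}
    {φ : Fin n → ℝ} (heig : A.mulVec φ = μ • φ) (hnz : ∀ i, φ i ≠ 0)
    (a : UpperSupport A → ℝ) (x : Fin n → ℝ) :
    ∑ p : UpperSupport A, -(A p.1.1 p.1.2 * φ p.1.1 * φ p.1.2) *
        (a p + (x p.1.1 / φ p.1.1 - x p.1.2 / φ p.1.2)) ^ 2
      = ∑ p : UpperSupport A, -(A p.1.1 p.1.2 * φ p.1.1 * φ p.1.2) * a p ^ 2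
        + 2 * ∑ p : UpperSupport A, -(A p.1.1 p.1.2 * a p) *
          (x p.1.1 * φ p.1.2 - x p.1.2 * φ p.1.1)
        + (x ⬝ᵥ A.mulVec x - μ * x ⬝ᵥ x) := by
  have hA' : ∀ i j, A i j = A j i := fun i j => hA.apply j i
  have key : ∑ p : UpperSupport A, -(A p.1.1 p.1.2 * φ p.1.1 * φ p.1.2) *
      (x p.1.1 / φ p.1.1 - x p.1.2 / φ p.1.2) ^ 2 = x ⬝ᵥ A.mulVec x - μ * x ⬝ᵥ x := by
    have h := two_mul_sum_upperSupport A
      (fun i j => -(A i j * φ i * φ j) * (x i / φ i - x j / φ j) ^ 2)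
      (fun i j => by rw [hA' i j]; ring) (fun i => by simp) (fun i j h => by simp [h])
    have h3 : ∀ i j, -(A i j * φ i * φ j) * (x i / φ i - x j / φ j) ^ 2
        = 2 * (x i * (A i j * x j)) - (x i ^ 2 / φ i) * (A i j * φ j)
          - (x j ^ 2 / φ j) * (A j i * φ i) := by
      intro i j
      have := hnz i
      have := hnz j
      rw [hA' j i]
      field_simp
      ring
    have h4 : ∑ i, ∑ j, (x i ^ 2 / φ i) * (A i j * φ j) = μ * x ⬝ᵥ x := by
      simp_rw [← Finset.mul_sum]
      rw [dotProduct, Finset.mul_sum]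
      refine Finset.sum_congr rfl fun i _ => ?_
      have := congrFun heig i
      simp only [Matrix.mulVec, dotProduct, Pi.smul_apply, smul_eq_mul] at this
      rw [this]
      have := hnz i
      field_simp
    have h5 : ∑ i, ∑ j, (x j ^ 2 / φ j) * (A j i * φ i) = μ * x ⬝ᵥ x := by
      rw [Finset.sum_comm, h4]
    have h6 : ∑ i, ∑ j, 2 * (x i * (A i j * x j)) = 2 * x ⬝ᵥ A.mulVec x := by
      simp only [Matrix.mulVec, dotProduct, Finset.mul_sum]
    simp only [h3, Finset.sum_sub_distrib, h4, h5, h6] at h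
    simp only [h3]
    simp only [Finset.sum_sub_distrib]
    linarith
  rw [← key, Finset.mul_sum, ← Finset.sum_add_distrib, ← Finset.sum_add_distrib]
  refine Finset.sum_congr rfl fun p _ => ?_
  have := hnz p.1.1
  have := hnz p.1.2
  field_simp
  ring

lemma card_edges_add_sum_le {n : ℕ} {A : Matrix (Fin n) (Fin n) ℝ} (hA : A.IsSymm)
    {lam : Fin n → ℝ} {φ : Fin n → Fin n → ℝ} (hlam : StrictMono lam)
    (heig : ∀ k, A.mulVec (φ k) = lam k • φ k)
    (horth : ∀ k m, φ k ⬝ᵥ φ m = if k = m then 1 else 0)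
    (hnz : ∀ k i, φ k i ≠ 0) (hn : 0 < n) :
    Fintype.card (UpperSupport A) + ∑ k : Fin n, (k : ℕ)
      ≤ ∑ k : Fin n, nodalCount A (φ k) + (n - 1) := by
  classical
  have hcomp : ∀ i j, ∑ k, φ k i * φ k j = if i = j then 1 else 0 := by
    have h1 : Matrix.of φ * (Matrix.of φ)ᵀ = 1 := by
      ext k m
      rw [Matrix.mul_apply, Matrix.one_apply, ← horth k m]
      rfl
    have h2 := mul_eq_one_comm.mp h1
    intro i j
    have := congrFun (congrFun h2 i) j
    rw [Matrix.mul_apply, Matrix.one_apply] at this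
    exact this
  let L : Fin n → Fin n → (UpperSupport A → ℝ) →ₗ[ℝ] ℝ := fun k m =>
    ∑ p : UpperSupport A, (-(A p.1.1 p.1.2) *
      (φ m p.1.1 * φ k p.1.2 - φ m p.1.2 * φ k p.1.1)) • LinearMap.proj p
  have hL : ∀ k m a, L k m a = ∑ p : UpperSupport A, -(A p.1.1 p.1.2 * a p) *
      (φ m p.1.1 * φ k p.1.2 - φ m p.1.2 * φ k p.1.1) := by
    intro k m a
    simp only [L, LinearMap.sum_apply, LinearMap.smul_apply, LinearMap.proj_apply, smul_eq_mul]
    exact Finset.sum_congr rfl fun p _ => by ring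
  have hLanti : ∀ k m a, L k m a = -L m k a := by
    intro k m a
    rw [hL, hL, ← Finset.sum_neg_distrib]
    exact Finset.sum_congr rfl fun p _ => by ring
  let y : Fin n → Fin n → (UpperSupport A → ℝ) × ((Σ k : Fin n, Fin k) → ℝ) →ₗ[ℝ] ℝ := fun k m =>
    if h : m < k then LinearMap.proj (⟨k, ⟨m, h⟩⟩ : Σ k : Fin n, Fin k) ∘ₗ LinearMap.snd ℝ _ _
    else 0
  let c : Fin n → Fin n → (UpperSupport A → ℝ) × ((Σ k : Fin n, Fin k) → ℝ) →ₗ[ℝ] ℝ := fun k m =>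
    y k m - (lam m - lam k)⁻¹ • (L k m ∘ₗ LinearMap.fst ℝ _ _)
  let x : Fin n → Fin n → (UpperSupport A → ℝ) × ((Σ k : Fin n, Fin k) → ℝ) →ₗ[ℝ] ℝ := fun k i => ∑ m, φ m i • c k m
  let u : Fin n → UpperSupport A → (UpperSupport A → ℝ) × ((Σ k : Fin n, Fin k) → ℝ) →ₗ[ℝ] ℝ := fun k p =>
    LinearMap.proj p ∘ₗ LinearMap.fst ℝ _ _
      + ((φ k p.1.1)⁻¹ • x k p.1.1 - (φ k p.1.2)⁻¹ • x k p.1.2)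
  let w : Fin n → UpperSupport A → ℝ := fun k p => -(A p.1.1 p.1.2 * φ k p.1.1 * φ k p.1.2)
  have hw : ∀ k p, w k p ≠ 0 := fun k p =>
    neg_ne_zero.mpr (mul_ne_zero (mul_ne_zero p.2.2 (hnz _ _)) (hnz _ _))
  have hc0 : ∀ k d, c k k d = 0 := by
    intro k d
    simp [c, y]
  have hform : ∀ k d, ∑ p, w k p * u k p d ^ 2 = ∑ p, w k p * d.1 p ^ 2
      - ∑ m, (lam m - lam k)⁻¹ * L k m d.1 ^ 2 + ∑ m, (lam m - lam k) * y k m d ^ 2 := by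
    intro k d
    have hx : (fun i => x k i d) = ∑ m, c k m d • φ m := by
      ext i
      simp [x, Finset.sum_apply, mul_comm]
    have h1 := sum_weight_sq hA (heig k) (hnz k) d.1 (fun i => x k i d)
    have hu : ∀ p, u k p d = d.1 p + (x k p.1.1 d / φ k p.1.1 - x k p.1.2 d / φ k p.1.2) := by
      intro p
      simp [u, div_eq_inv_mul]
    simp only [w, hu]
    rw [h1]
    have h2 : (fun i => x k i d) ⬝ᵥ A.mulVec (fun i => x k i d)
        - lam k * (fun i => x k i d) ⬝ᵥ (fun i => x k i d)
        = ∑ m, (lam m - lam k) * c k m d ^ 2 := by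
      rw [hx, Matrix.mulVec_sum]
      simp only [Matrix.mulVec_smul, heig, sum_dotProduct, dotProduct_sum, smul_dotProduct,
        dotProduct_smul, horth, smul_eq_mul, mul_ite, mul_one, mul_zero,
        Finset.sum_ite_eq', Finset.mem_univ, if_true, Finset.mul_sum]
      rw [← Finset.sum_sub_distrib]
      exact Finset.sum_congr rfl fun m _ => by ring
    have h3 : ∑ p : UpperSupport A, -(A p.1.1 p.1.2 * d.1 p) *
        (x k p.1.1 d * φ k p.1.2 - x k p.1.2 d * φ k p.1.1) = ∑ m, c k m d * L k m d.1 := by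
      simp only [hL, Finset.mul_sum]
      rw [Finset.sum_comm]
      refine Finset.sum_congr rfl fun p _ => ?_
      simp only [x, LinearMap.sum_apply, LinearMap.smul_apply, smul_eq_mul]
      rw [Finset.sum_mul, Finset.sum_mul, ← Finset.sum_sub_distrib, Finset.mul_sum]
      exact Finset.sum_congr rfl fun m _ => by ring
    rw [h2, h3, Finset.mul_sum, add_assoc, ← Finset.sum_add_distrib, sub_add,
      ← Finset.sum_sub_distrib, sub_eq_add_neg, ← Finset.sum_neg_distrib]
    congr 1
    refine Finset.sum_congr rfl fun m _ => ?_
    rcases eq_or_ne m k with rfl | hmk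
    · simp [hc0, y]
    · have : lam m - lam k ≠ 0 := sub_ne_zero.mpr (hlam.injective.ne hmk)
      simp only [c, LinearMap.sub_apply, LinearMap.smul_apply, LinearMap.comp_apply,
        LinearMap.fst_apply, smul_eq_mul]
      field_simp
      ring
  have htotal : ∀ d, ∑ k, ∑ p, w k p * u k p d ^ 2
      = ∑ k, ∑ m, (lam m - lam k) * y k m d ^ 2 := by
    intro d
    simp only [hform, Finset.sum_add_distrib, Finset.sum_sub_distrib]
    have h1 : ∑ k, ∑ p, w k p * d.1 p ^ 2 = 0 := by
      rw [Finset.sum_comm]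
      refine Finset.sum_eq_zero fun p _ => ?_
      have := hcomp p.1.1 p.1.2
      rw [if_neg p.2.1.ne] at this
      calc _ = -A p.1.1 p.1.2 * d.1 p ^ 2 * ∑ k, φ k p.1.1 * φ k p.1.2 := by
            rw [Finset.mul_sum]
            exact Finset.sum_congr rfl fun k _ => by simp only [w]; ring
        _ = 0 := by rw [this, mul_zero]
    have h2 : ∑ k, ∑ m, (lam m - lam k)⁻¹ * L k m d.1 ^ 2 = 0 := by
      have : ∑ k, ∑ m, (lam m - lam k)⁻¹ * L k m d.1 ^ 2
          = -∑ k, ∑ m, (lam m - lam k)⁻¹ * L k m d.1 ^ 2 := by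
        conv_rhs => rw [Finset.sum_comm]
        rw [← Finset.sum_neg_distrib]
        refine Finset.sum_congr rfl fun k _ => ?_
        rw [← Finset.sum_neg_distrib]
        refine Finset.sum_congr rfl fun m _ => ?_
        rw [hLanti k m, neg_sq, ← neg_mul, ← inv_neg, neg_sub]
      linarith
    rw [h1, h2, sub_zero, zero_add]
  let Cod := ((Σ k : Fin n, {p : UpperSupport A // w k p < 0}) → ℝ)
    × ({m : Fin n // m ≠ ⟨0, hn⟩} → ℝ)
  let Ψ : (UpperSupport A → ℝ) × ((Σ k : Fin n, Fin k) → ℝ) →ₗ[ℝ] Cod := LinearMap.prod (LinearMap.pi fun q => u q.1 q.2.1)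
    (LinearMap.pi fun m => L ⟨0, hn⟩ m.1 ∘ₗ LinearMap.fst ℝ _ _)
  have hinj : Function.Injective Ψ := by
    rw [← LinearMap.ker_eq_bot, LinearMap.ker_eq_bot']
    intro d hd
    have hu0 : ∀ k p, w k p < 0 → u k p d = 0 := fun k p h =>
      congrFun (congrArg Prod.fst hd) ⟨k, ⟨p, h⟩⟩
    have hL0 : ∀ m, m ≠ ⟨0, hn⟩ → L ⟨0, hn⟩ m d.1 = 0 := fun m h =>
      congrFun (congrArg Prod.snd hd) ⟨m, h⟩
    have hpos : ∀ k p, 0 ≤ w k p * u k p d ^ 2 := by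
      intro k p
      rcases lt_or_gt_of_ne (hw k p) with h | h
      · simp [hu0 k p h]
      · positivity
    have hnonpos : ∀ k m, (lam m - lam k) * y k m d ^ 2 ≤ 0 := by
      intro k m
      by_cases h : m < k
      · exact mul_nonpos_of_nonpos_of_nonneg (sub_nonpos.mpr (hlam h).le) (sq_nonneg _)
      · simp [y, h]
    have hS1 : 0 ≤ ∑ k, ∑ p, w k p * u k p d ^ 2 :=
      Finset.sum_nonneg fun k _ => Finset.sum_nonneg fun p _ => hpos k p
    have hS2 : ∑ k, ∑ m, (lam m - lam k) * y k m d ^ 2 ≤ 0 :=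
      Finset.sum_nonpos fun k _ => Finset.sum_nonpos fun p _ => hnonpos k p
    have hT := htotal d
    have hu1 : ∀ k p, u k p d = 0 := by
      intro k p
      have h1 := (Finset.sum_eq_zero_iff_of_nonneg fun k _ =>
        Finset.sum_nonneg fun p _ => hpos k p).mp (by linarith) k (Finset.mem_univ k)
      have h2 := (Finset.sum_eq_zero_iff_of_nonneg fun p _ => hpos k p).mp h1 p
        (Finset.mem_univ p)
      simpa [hw k p] using h2
    have hy : ∀ k m, (h : m < k) → y k m d = 0 := by
      intro k m h
      have h1 := (Finset.sum_eq_zero_iff_of_nonpos fun k _ =>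
        Finset.sum_nonpos fun p _ => hnonpos k p).mp (by linarith) k (Finset.mem_univ k)
      have h2 := (Finset.sum_eq_zero_iff_of_nonpos fun p _ => hnonpos k p).mp h1 m
        (Finset.mem_univ m)
      simpa [(sub_neg.mpr (hlam h)).ne] using h2
    have hd2 : d.2 = 0 := by
      ext ⟨k, m⟩
      have h : (⟨m, m.2.trans k.2⟩ : Fin n) < k := m.2
      have := hy k _ h
      simpa [y, h] using this
    have hx0 : ∀ i, x ⟨0, hn⟩ i d = 0 := by
      intro i
      simp only [x, LinearMap.sum_apply, LinearMap.smul_apply, smul_eq_mul]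
      refine Finset.sum_eq_zero fun m _ => ?_
      rcases eq_or_ne m ⟨0, hn⟩ with rfl | h
      · rw [hc0, mul_zero]
      · have : y ⟨0, hn⟩ m = 0 := dif_neg (by simp [Fin.lt_def])
        simp [c, this, hL0 m h]
    have hd1 : d.1 = 0 := by
      ext p
      have := hu1 ⟨0, hn⟩ p
      simpa [u, hx0] using this
    exact Prod.ext hd1 hd2
  have hcard := LinearMap.finrank_le_finrank_of_injective hinj
  have hnodal : ∀ k, Fintype.card {p : UpperSupport A // w k p < 0} = nodalCount A (φ k) := by
    intro k
    rw [nodalCount, ← Nat.card_eq_fintype_card]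
    refine Nat.card_congr
      { toFun := fun p => ⟨p.1.1, p.1.2.1, neg_neg_iff_pos.mp p.2⟩
        invFun := fun p => ⟨⟨p.1, p.2.1, fun h => by simpa [h] using p.2.2⟩,
          neg_neg_iff_pos.mpr p.2.2⟩
        left_inv := fun p => rfl
        right_inv := fun p => rfl }
  simp only [Cod, Module.finrank_prod, Module.finrank_fintype_fun_eq_card, Fintype.card_sigma,
    Fintype.card_fin, hnodal, Fintype.card_subtype_compl, Fintype.card_unique, ne_eq] at hcard
  exact hcard

/-- The matrix whose columns are the iterates `N ^ j *ᵥ e_z`, `j < n`. -/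
def krylov {n : ℕ} {R : Type*} [CommRing R] (N : Matrix (Fin n) (Fin n) R) (z : Fin n) :
    Matrix (Fin n) (Fin n) R :=
  Matrix.of fun i j => (N ^ (j : ℕ)) i z

lemma krylov_map {n : ℕ} {R S : Type*} [CommRing R] [CommRing S] (f : R →+* S)
    (N : Matrix (Fin n) (Fin n) R) (z : Fin n) :
    krylov (N.map f) z = (krylov N z).map f := by
  ext i j
  have h : (N.map f) ^ (j : ℕ) = (N ^ (j : ℕ)).map f := by
    simpa using (map_pow f.mapMatrix N j).symm
  simp only [krylov, Matrix.of_apply, h, Matrix.map_apply]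

lemma det_krylov_map {n : ℕ} {R S : Type*} [CommRing R] [CommRing S] (f : R →+* S)
    (N : Matrix (Fin n) (Fin n) R) (z : Fin n) :
    (krylov (N.map f) z).det = f (krylov N z).det := by
  rw [krylov_map, RingHom.map_det, RingHom.mapMatrix_apply]

lemma continuous_det_krylov {n : ℕ} (z : Fin n) :
    Continuous fun N : Matrix (Fin n) (Fin n) ℝ => (krylov N z).det := by
  unfold krylov
  fun_prop

lemma vecMul_krylov_apply {n : ℕ} {R : Type*} [CommRing R] (N : Matrix (Fin n) (Fin n) R)
    (z j : Fin n) (v : Fin n → R) : (v ᵥ* krylov N z) j = (v ᵥ* N ^ (j : ℕ)) z := rfl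

lemma eigenvector_apply_ne_zero {n : ℕ} {N : Matrix (Fin n) (Fin n) ℝ} {z : Fin n}
    (h : (krylov N z).det ≠ 0) {v : Fin n → ℝ} {μ : ℝ} (hv : v ᵥ* N = μ • v) (hv0 : v ≠ 0) :
    v z ≠ 0 := by
  intro hz
  refine hv0 (Matrix.eq_zero_of_vecMul_eq_zero h ?_)
  have hpow : ∀ j : ℕ, v ᵥ* N ^ j = μ ^ j • v := by
    intro j
    induction j with
    | zero => simp
    | succ j ih => rw [pow_succ, ← Matrix.vecMul_vecMul, ih, Matrix.smul_vecMul, hv, smul_smul,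
        pow_succ]
  ext j
  rw [vecMul_krylov_apply, hpow, Pi.smul_apply, hz, smul_zero, Pi.zero_apply]

lemma det_krylov_ne_zero {n : ℕ} {K : Type*} [Field K] [IsAlgClosed K]
    (N : Matrix (Fin n) (Fin n) K) (z : Fin n)
    (h : ∀ (μ : K) (v : Fin n → K), v ᵥ* N = μ • v → v z = 0 → v = 0) :
    (krylov N z).det ≠ 0 := by
  intro hdet
  obtain ⟨v, hv0, hv⟩ := Matrix.exists_vecMul_eq_zero_iff.mpr hdet
  let W : Submodule K (Fin n → K) :=
    { carrier := {w | ∀ j : ℕ, (w ᵥ* N ^ j) z = 0}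
      add_mem' := fun {a b} ha hb j => by
        rw [Matrix.add_vecMul, Pi.add_apply, ha j, hb j, add_zero]
      zero_mem' := fun j => by rw [Matrix.zero_vecMul, Pi.zero_apply]
      smul_mem' := fun c a ha j => by
        rw [Matrix.smul_vecMul, Pi.smul_apply, ha j, smul_zero] }
  have hvW : v ∈ W := by
    intro j
    have hn : 0 < n := z.pos
    have hdeg : (Polynomial.X ^ j %ₘ N.charpoly).natDegree < n := by
      have h1 : N.charpoly.natDegree = n := by simp
      have := Polynomial.natDegree_modByMonic_lt (Polynomial.X ^ j) N.charpoly_monic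
        (fun h => by rw [h, Polynomial.natDegree_one] at h1; omega)
      omega
    rw [Matrix.pow_eq_aeval_mod_charpoly, Polynomial.aeval_eq_sum_range' hdeg,
      Matrix.vecMul_sum, Finset.sum_apply]
    refine Finset.sum_eq_zero fun i hi => ?_
    have := congrFun hv ⟨i, Finset.mem_range.mp hi⟩
    rw [vecMul_krylov_apply] at this
    rw [Matrix.vecMul_smul, Pi.smul_apply, this, Pi.zero_apply, smul_zero]
  have hinv : ∀ w ∈ W, N.vecMulLinear w ∈ W := by
    intro w hw j
    rw [Matrix.vecMulLinear_apply, Matrix.vecMul_vecMul, ← pow_succ']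
    exact hw (j + 1)
  have : Nontrivial W := ⟨⟨⟨v, hvW⟩, 0, fun h => hv0 (congrArg Subtype.val h)⟩⟩
  obtain ⟨μ, hμ⟩ := Module.End.exists_eigenvalue (N.vecMulLinear.restrict hinv)
  obtain ⟨w, hw⟩ := hμ.exists_hasEigenvector
  refine hw.2 (Subtype.ext (h μ w.1 (congrArg Subtype.val hw.apply_eq_smul) ?_))
  simpa using w.2 0

lemma exists_iterate_parent_of_eigenvector {n : ℕ} {z : Fin n} {par : Fin n → Fin n}
    {dep : Fin n → ℕ} (hdep : ∀ i, i ≠ z → dep i = dep (par i) + 1) {d v : Fin n → ℂ} {μ : ℂ}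
    (hv : ∀ p, d p * v p + ∑ i, (if i ≠ z ∧ par i = p then v i else 0) = μ * v p)
    {i : Fin n} (hi : v i ≠ 0) :
    ∃ l k, par^[k] l = i ∧ dep l = dep i + k ∧ d l = μ := by
  obtain ⟨b, hb⟩ : ∃ b, ∀ i, dep i ≤ b :=
    ⟨Finset.univ.sup dep, fun i => Finset.le_sup (Finset.mem_univ i)⟩
  induction hm : b - dep i using Nat.strong_induction_on generalizing i with
  | _ m ih =>
    by_cases hd : d i = μ
    · exact ⟨i, 0, rfl, rfl, hd⟩
    · have hsum : ∑ j, (if j ≠ z ∧ par j = i then v j else 0) ≠ 0 := by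
        intro h0
        have := hv i
        rw [h0, add_zero] at this
        exact hd (mul_right_cancel₀ hi this)
      obtain ⟨j, -, hj⟩ := Finset.exists_ne_zero_of_sum_ne_zero hsum
      obtain ⟨⟨hjz, hji⟩, hvj⟩ := ite_ne_right_iff.mp hj
      have h1 := hdep j hjz
      rw [hji] at h1
      have := hb j
      obtain ⟨l, k, hl, hk, hdl⟩ := ih (b - dep j) (by omega) hvj rfl
      refine ⟨l, k + 1, ?_, by omega, hdl⟩
      rw [Function.iterate_succ_apply', hl, hji]

lemma eq_zero_of_tree_eigenvector {n : ℕ} {z : Fin n} {par : Fin n → Fin n}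
    {dep : Fin n → ℕ} (hdep : ∀ i, i ≠ z → dep i = dep (par i) + 1) {d v : Fin n → ℂ}
    (hd : Function.Injective d) {μ : ℂ}
    (hv : ∀ p, d p * v p + ∑ i, (if i ≠ z ∧ par i = p then v i else 0) = μ * v p)
    (hz : v z = 0) : v = 0 := by
  by_contra hne
  obtain ⟨w₀, hw₀⟩ := Function.ne_iff.mp hne
  obtain ⟨w, hw, hmin⟩ := Finset.exists_min_image (Finset.univ.filter fun i => v i ≠ 0) dep
    ⟨w₀, by simpa using hw₀⟩
  simp only [Finset.mem_filter_univ] at hw hmin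
  have hwz : w ≠ z := fun h => hw (h ▸ hz)
  have hpar : v (par w) = 0 := by
    by_contra h
    have := hmin _ h
    have := hdep w hwz
    omega
  have hsum := hv (par w)
  rw [hpar, mul_zero, mul_zero, zero_add] at hsum
  refine hw ?_
  rw [Finset.sum_eq_single w] at hsum
  · simpa [hwz] using hsum
  · intro w' _ hw'
    by_contra hc
    obtain ⟨⟨hz', hp'⟩, hv'⟩ := ite_ne_right_iff.mp hc
    obtain ⟨l, k, hl, hk, hdl⟩ := exists_iterate_parent_of_eigenvector hdep hv hw
    obtain ⟨l', k', hl', hk', hdl'⟩ := exists_iterate_parent_of_eigenvector hdep hv hv'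
    obtain rfl : l = l' := hd (hdl.trans hdl'.symm)
    have h1 := hdep w hwz
    have h2 := hdep w' hz'
    rw [hp'] at h2
    obtain rfl : k = k' := by omega
    exact hw' (hl'.symm.trans hl)
  · simp

lemma exists_parent_function {n : ℕ} {G : SimpleGraph (Fin n)} (hG : G.Connected) (z : Fin n) :
    ∃ par : Fin n → Fin n,
      ∀ i, i ≠ z → G.Adj i (par i) ∧ G.dist z i = G.dist z (par i) + 1 := by
  have h : ∀ i, ∃ p, i ≠ z → G.Adj i p ∧ G.dist z i = G.dist z p + 1 := by
    intro i
    by_cases hi : i = z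
    · exact ⟨i, fun h => absurd hi h⟩
    · obtain ⟨w, hw⟩ := hG.exists_walk_length_eq_dist i z
      cases w with
      | nil => exact absurd rfl hi
      | @cons _ p _ hadj q =>
        refine ⟨p, fun _ => ⟨hadj, ?_⟩⟩
        rw [SimpleGraph.Walk.length_cons] at hw
        have h1 := SimpleGraph.dist_le q
        have h2 := hG.dist_triangle (u := i) (v := p) (w := z)
        rw [SimpleGraph.dist_eq_one_iff_adj.mpr hadj] at h2
        rw [SimpleGraph.dist_comm (u := z) (v := i), SimpleGraph.dist_comm (u := z) (v := p)]
        omega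
  exact ⟨fun i => (h i).choose, fun i => (h i).choose_spec⟩

lemma exists_det_krylov_ne_zero {n : ℕ} {G : SimpleGraph (Fin n)} (hG : G.Connected)
    (z : Fin n) :
    ∃ B : Matrix (Fin n) (Fin n) ℝ, B.IsSymm ∧ SupportedOn G B ∧ (krylov B z).det ≠ 0 := by
  obtain ⟨par, hpar⟩ := exists_parent_function hG z
  let D : Matrix (Fin n) (Fin n) ℝ := Matrix.diagonal fun i => (i : ℝ)
  let T : Matrix (Fin n) (Fin n) ℝ := Matrix.of fun i j => if i ≠ z ∧ par i = j then 1 else 0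
  have hT : ∀ i j, T i j ≠ 0 → G.Adj i j ∧ G.dist z i = G.dist z j + 1 := by
    intro i j h
    have h' : i ≠ z ∧ par i = j := by
      by_contra hc
      exact h (if_neg hc)
    rw [← h'.2]
    exact hpar i h'.1
  have h0 : (krylov (D + T) z).det ≠ 0 := by
    have h1 : (krylov ((D + T).map Complex.ofRealHom) z).det ≠ 0 := by
      refine det_krylov_ne_zero _ z fun μ v hv hz =>
        eq_zero_of_tree_eigenvector (fun i hi => (hpar i hi).2) (d := fun i => (i : ℂ)) ?_
          (μ := μ) (fun p => ?_) hz
      · intro i j hij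
        exact Fin.ext (Nat.cast_injective hij)
      · have := congrFun hv p
        rw [Pi.smul_apply, smul_eq_mul] at this
        rw [← this]
        simp only [Matrix.vecMul, dotProduct, Matrix.map_apply, Matrix.add_apply, map_add, mul_add,
          Finset.sum_add_distrib]
        congr 1
        · rw [Finset.sum_eq_single p (fun i _ hi => by simp [D, Matrix.diagonal_apply_ne _ hi])
            (by simp)]
          simp [D, mul_comm]
        · refine Finset.sum_congr rfl fun i _ => ?_
          by_cases h : i ≠ z ∧ par i = p
          · simp [T, h]
          · simp only [T, Matrix.of_apply, if_neg h, map_zero, mul_zero]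
    rw [det_krylov_map] at h1
    exact fun h => h1 (by rw [h, map_zero])
  obtain ⟨ε, hε, hdet⟩ : ∃ ε : ℝ, ε ≠ 0 ∧ (krylov (D + T + ε ^ 2 • Tᵀ) z).det ≠ 0 := by
    have hcont : Continuous fun ε : ℝ => (krylov (D + T + ε ^ 2 • Tᵀ) z).det :=
      (continuous_det_krylov z).comp (by fun_prop)
    have h1 : ∀ᶠ ε in nhds (0 : ℝ), (krylov (D + T + ε ^ 2 • Tᵀ) z).det ≠ 0 :=
      hcont.continuousAt.eventually_ne (by simpa using h0)
    obtain ⟨ε, h2, h3⟩ := ((h1.filter_mono nhdsWithin_le_nhds).and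
      (self_mem_nhdsWithin : {0}ᶜ ∈ nhdsWithin (0 : ℝ) {0}ᶜ)).exists
    exact ⟨ε, h3, h2⟩
  refine ⟨D + ε • (T + Tᵀ), ?_, ?_, ?_⟩
  · refine (Matrix.isSymm_diagonal _).add (Matrix.IsSymm.smul ?_ ε)
    exact Matrix.isSymm_add_transpose_self T
  · intro i j hij hadj
    have h1 : T i j = 0 := by
      by_contra h
      exact hadj (hT i j h).1
    have h2 : T j i = 0 := by
      by_contra h
      exact hadj (hT j i h).1.symm
    simp [D, Matrix.diagonal_apply_ne _ hij, h1, h2]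
  · set N := D + T + ε ^ 2 • Tᵀ
    set M := D + ε • (T + Tᵀ)
    let S : Matrix (Fin n) (Fin n) ℝ := Matrix.diagonal fun i => ε ^ G.dist z i
    have hMS : M * S = S * N := by
      ext i j
      rw [Matrix.mul_diagonal, Matrix.diagonal_mul]
      simp only [M, N, Matrix.add_apply, Matrix.smul_apply, Matrix.transpose_apply, smul_eq_mul]
      have h1 : D i j * ε ^ G.dist z j = ε ^ G.dist z i * D i j := by
        rcases eq_or_ne i j with rfl | h
        · exact mul_comm _ _
        · simp [D, Matrix.diagonal_apply_ne _ h]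
      have h2 : ε * T i j * ε ^ G.dist z j = ε ^ G.dist z i * T i j := by
        by_cases h : T i j = 0
        · simp [h]
        · rw [(hT i j h).2]
          ring
      have h3 : ε * T j i * ε ^ G.dist z j = ε ^ G.dist z i * (ε ^ 2 * T j i) := by
        by_cases h : T j i = 0
        · simp [h]
        · rw [(hT j i h).2]
          ring
      linear_combination h1 + h2 + h3
    have hpow : ∀ j : ℕ, M ^ j * S = S * N ^ j := by
      intro j
      induction j with
      | zero => simp
      | succ j ih => rw [pow_succ', Matrix.mul_assoc, ih, ← Matrix.mul_assoc, hMS,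
          Matrix.mul_assoc, ← pow_succ']
    have hkry : krylov M z = S * krylov N z := by
      ext i j
      have := congrFun (congrFun (hpow j) i) z
      rw [Matrix.mul_diagonal, Matrix.diagonal_mul, SimpleGraph.dist_self, pow_zero,
        mul_one] at this
      rw [Matrix.diagonal_mul]
      exact this
    rw [hkry, Matrix.det_mul, Matrix.det_diagonal]
    exact mul_ne_zero (Finset.prod_ne_zero_iff.mpr fun i _ => pow_ne_zero _ hε) hdet

/-- Symmetric matrices supported on a connected graph all of whose eigenvectors vanish nowhere
are dense. -/
lemma mem_closure_det_krylov_ne_zero {n : ℕ} {G : SimpleGraph (Fin n)} (hG : G.Connected)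
    (s : Finset (Fin n)) {A : Matrix (Fin n) (Fin n) ℝ} (hA : A.IsSymm)
    (hsupp : SupportedOn G A) :
    A ∈ closure {M : Matrix (Fin n) (Fin n) ℝ |
      M.IsSymm ∧ SupportedOn G M ∧ ∀ z ∈ s, (krylov M z).det ≠ 0} := by
  induction s using Finset.induction_on with
  | empty => exact subset_closure ⟨hA, hsupp, by simp⟩
  | insert z s hz ih =>
    refine closure_minimal ?_ isClosed_closure ih
    rintro M ⟨hM, hMsupp, hMs⟩
    obtain ⟨B, hB, hBsupp, hBz⟩ := exists_det_krylov_ne_zero hG z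
    let line : ℝ → Matrix (Fin n) (Fin n) ℝ := fun t => M + t • (B - M)
    have hline : Continuous line := by fun_prop
    have hline0 : line 0 = M := by simp [line]
    have htend : Filter.Tendsto line (nhdsWithin 0 {0}ᶜ) (nhds M) := by
      have := hline.tendsto 0
      rw [hline0] at this
      exact this.mono_left nhdsWithin_le_nhds
    refine mem_closure_of_tendsto htend ?_
    have h1 : ∀ᶠ t in nhdsWithin (0 : ℝ) {0}ᶜ, ∀ y ∈ s, (krylov (line t) y).det ≠ 0 := by
      rw [Filter.eventually_all_finset]
      intro y hy
      exact htend.eventually ((continuous_det_krylov y).continuousAt.eventually_ne (hMs y hy))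
    have h2 : ∀ᶠ t in nhdsWithin (0 : ℝ) {0}ᶜ, (krylov (line t) z).det ≠ 0 := by
      let P : Polynomial ℝ := (krylov (M.map Polynomial.C
        + (Polynomial.X : Polynomial ℝ) • (B - M).map Polynomial.C) z).det
      have hP : ∀ t, P.eval t = (krylov (line t) z).det := by
        intro t
        rw [← Polynomial.coe_evalRingHom, ← det_krylov_map]
        congr 2
        ext i j
        simp [line]
      have hP0 : P ≠ 0 := by
        intro h
        have := hP 1
        rw [h, Polynomial.eval_zero] at this
        exact hBz (by simpa [line] using this.symm)
      have hfin : ({t | P.IsRoot t} \ {0}).Finite :=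
        (Polynomial.finite_setOfPred_isRoot hP0).subset Set.sdiff_subset
      filter_upwards [nhdsWithin_le_nhds (hfin.isClosed.isOpen_compl.mem_nhds (by simp)),
        self_mem_nhdsWithin] with t ht ht0
      rw [← hP]
      exact fun h => ht ⟨h, ht0⟩
    filter_upwards [h1, h2] with t ht1 ht2
    refine ⟨hM.add ((hB.sub hM).smul t), fun i j hij hadj => ?_, fun y hy => ?_⟩
    · simp [line, hMsupp i j hij hadj, hBsupp i j hij hadj]
    · rcases Finset.mem_insert.mp hy with rfl | h
      · exact ht2
      · exact ht1 y h

lemma card_upperSupport_neg {n : ℕ} (A : Matrix (Fin n) (Fin n) ℝ) :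
    Fintype.card (UpperSupport (-A)) = Fintype.card (UpperSupport A) :=
  Fintype.card_congr (Equiv.subtypeEquivRight fun _ => by simp)

lemma nodalCount_neg_add_nodalCount {n : ℕ} (A : Matrix (Fin n) (Fin n) ℝ) {φ : Fin n → ℝ}
    (hnz : ∀ i, φ i ≠ 0) :
    nodalCount (-A) φ + nodalCount A φ = Fintype.card (UpperSupport A) := by
  classical
  let w : UpperSupport A → ℝ := fun p => A p.1.1 p.1.2 * φ p.1.1 * φ p.1.2
  have hw : ∀ p, w p ≠ 0 := fun p => mul_ne_zero (mul_ne_zero p.2.2 (hnz _)) (hnz _)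
  have h1 : nodalCount A φ = Fintype.card {p // 0 < w p} := by
    rw [nodalCount, ← Nat.card_eq_fintype_card]
    exact Nat.card_congr
      { toFun := fun p => ⟨⟨p.1, p.2.1, fun h => by simpa [h] using p.2.2⟩, p.2.2⟩
        invFun := fun p => ⟨p.1.1, p.1.2.1, p.2⟩
        left_inv := fun p => rfl
        right_inv := fun p => rfl }
  have h2 : nodalCount (-A) φ = Fintype.card {p // ¬ 0 < w p} := by
    rw [nodalCount, ← Nat.card_eq_fintype_card]
    refine Nat.card_congr
      { toFun := fun p => ⟨⟨p.1, p.2.1, fun h => by simpa [h] using p.2.2⟩, fun h => ?_⟩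
        invFun := fun p => ⟨p.1.1, p.1.2.1, ?_⟩
        left_inv := fun p => rfl
        right_inv := fun p => rfl }
    · have h3 := p.2.2
      simp only [w] at h
      simp only [Matrix.neg_apply, neg_mul] at h3
      linarith
    · have h3 := lt_of_le_of_ne (not_lt.mp p.2) (hw p.1)
      simp only [w] at h3
      simp only [Matrix.neg_apply, neg_mul]
      linarith
  rw [h1, h2, Fintype.card_subtype_compl]
  exact Nat.sub_add_cancel (Fintype.card_subtype_le _)

lemma sum_nodalCount_add_sum_le {n : ℕ} {A : Matrix (Fin n) (Fin n) ℝ} (hA : A.IsSymm)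
    {lam : Fin n → ℝ} {φ : Fin n → Fin n → ℝ} (hlam : StrictMono lam)
    (heig : ∀ k, A.mulVec (φ k) = lam k • φ k)
    (horth : ∀ k m, φ k ⬝ᵥ φ m = if k = m then 1 else 0)
    (hnz : ∀ k i, φ k i ≠ 0) (hn : 0 < n) :
    ∑ k : Fin n, nodalCount A (φ k) + Fintype.card (UpperSupport A) + ∑ k : Fin n, (k : ℕ)
      ≤ n * Fintype.card (UpperSupport A) + (n - 1) := by
  have h := card_edges_add_sum_le (A := -A) (lam := fun k => -lam k.rev) (φ := fun k => φ k.rev)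
    hA.neg (fun k m hkm => neg_lt_neg (hlam (Fin.rev_lt_rev.mpr hkm)))
    (fun k => by rw [Matrix.neg_mulVec, heig, neg_smul])
    (fun k m => by rw [horth]; simp) (fun k => hnz _) hn
  have h2 : ∑ k : Fin n, nodalCount (-A) (φ k.rev) = ∑ k, nodalCount (-A) (φ k) :=
    Fintype.sum_equiv Fin.revPerm _ _ fun k => rfl
  have h3 : ∑ k : Fin n, nodalCount (-A) (φ k) + ∑ k, nodalCount A (φ k)
      = n * Fintype.card (UpperSupport A) := by
    rw [← Finset.sum_add_distrib]
    simp [nodalCount_neg_add_nodalCount A (hnz _)]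
  rw [card_upperSupport_neg, h2] at h
  omega

lemma exists_sorted_orthonormal_eigenbasis {n : ℕ} {M : Matrix (Fin n) (Fin n) ℝ}
    (hM : M.IsSymm) :
    ∃ (lam : Fin n → ℝ) (φ : Fin n → Fin n → ℝ), Monotone lam ∧
      (∀ k, M.mulVec (φ k) = lam k • φ k) ∧
      ∀ k m, φ k ⬝ᵥ φ m = if k = m then 1 else 0 := by
  have hH : M.IsHermitian := by
    rw [Matrix.IsHermitian, Matrix.conjTranspose_eq_transpose_of_trivial]
    exact hM
  let σ := Tuple.sort hH.eigenvalues
  refine ⟨hH.eigenvalues ∘ σ, fun k => (hH.eigenvectorBasis (σ k)).ofLp,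
    Tuple.monotone_sort _, fun k => hH.mulVec_eigenvectorBasis _, fun k m => ?_⟩
  have := orthonormal_iff_ite.mp hH.eigenvectorBasis.orthonormal (σ m) (σ k)
  rw [EuclideanSpace.inner_eq_star_dotProduct] at this
  simpa [eq_comm] using this

lemma completeness_of_orthonormal {n : ℕ} {ψ : Fin n → Fin n → ℝ}
    (horth : ∀ k m, ψ k ⬝ᵥ ψ m = if k = m then 1 else 0) (v : Fin n → ℝ) :
    v = ∑ k, (ψ k ⬝ᵥ v) • ψ k := by
  have h1 : Matrix.of ψ * (Matrix.of ψ)ᵀ = 1 := by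
    ext k m
    rw [Matrix.mul_apply, Matrix.one_apply, ← horth k m]
    rfl
  have h2 : (Matrix.of ψ)ᵀ *ᵥ (Matrix.of ψ *ᵥ v) = v := by
    rw [Matrix.mulVec_mulVec, mul_eq_one_comm.mp h1, Matrix.one_mulVec]
  ext i
  rw [Finset.sum_apply]
  nth_rewrite 1 [← h2]
  simp only [Matrix.mulVec, dotProduct, Matrix.transpose_apply, Matrix.of_apply, Pi.smul_apply,
    smul_eq_mul]
  exact Finset.sum_congr rfl fun k _ => mul_comm _ _

lemma dotProduct_eigenvector_eq_zero {n : ℕ} {A : Matrix (Fin n) (Fin n) ℝ} (hA : A.IsSymm)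
    {v w : Fin n → ℝ} {μ ν : ℝ} (hv : A.mulVec v = μ • v) (hw : A.mulVec w = ν • w)
    (hne : μ ≠ ν) : v ⬝ᵥ w = 0 := by
  have h1 : v ⬝ᵥ A.mulVec w = A.mulVec v ⬝ᵥ w := by
    rw [Matrix.dotProduct_mulVec, ← Matrix.mulVec_transpose, hA.eq]
  rw [hv, hw, dotProduct_smul, smul_dotProduct, smul_eq_mul, smul_eq_mul] at h1
  have h2 : (ν - μ) * (v ⬝ᵥ w) = 0 := by linear_combination h1
  exact (mul_eq_zero.mp h2).resolve_left (sub_ne_zero.mpr hne.symm)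

/-- A sorted orthonormal eigenbasis of a matrix with simple spectrum agrees, up to nonzero
factors, with any family of eigenvectors listed in increasing order. -/
lemma eigenbasis_unique {n : ℕ} {A : Matrix (Fin n) (Fin n) ℝ} (hA : A.IsSymm)
    {lam : Fin n → ℝ} {φ : Fin n → Fin n → ℝ} (hlam : StrictMono lam)
    (heig : ∀ k, A.mulVec (φ k) = lam k • φ k) (hne : ∀ k, φ k ≠ 0)
    {μ : Fin n → ℝ} {ψ : Fin n → Fin n → ℝ} (hμ : Monotone μ)
    (heig' : ∀ k, A.mulVec (ψ k) = μ k • ψ k)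
    (horth : ∀ k m, ψ k ⬝ᵥ ψ m = if k = m then 1 else 0) :
    μ = lam ∧ ∃ c : Fin n → ℝ, ∀ k, c k ≠ 0 ∧ φ k = c k • ψ k := by
  have hex : ∀ m, ∃ k, μ k = lam m := by
    intro m
    by_contra! h
    refine hne m ?_
    rw [completeness_of_orthonormal horth (φ m)]
    exact Finset.sum_eq_zero fun k _ => by
      rw [dotProduct_eigenvector_eq_zero hA (heig' k) (heig m) (h k), zero_smul]
  choose g hg using hex
  have hgmono : StrictMono g := by
    intro a b hab
    by_contra! h
    have := hμ h
    rw [hg, hg] at this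
    exact (hlam hab).not_ge this
  have hgid : g = id := by
    refine (hgmono.range_inj strictMono_id).mp ?_
    rw [(Finite.injective_iff_surjective.mp hgmono.injective).range_eq, Set.range_id]
  have hμlam : μ = lam := by
    ext m
    rw [← hg m, hgid, id]
  refine ⟨hμlam, fun k => ψ k ⬝ᵥ φ k, fun k => ?_⟩
  have h1 : φ k = (ψ k ⬝ᵥ φ k) • ψ k := by
    nth_rewrite 1 [completeness_of_orthonormal horth (φ k)]
    refine Finset.sum_eq_single k (fun m _ hm => ?_) (by simp)
    rw [dotProduct_eigenvector_eq_zero hA (heig' m) (heig k)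
      (by rw [hμlam]; exact hlam.injective.ne hm), zero_smul]
  refine ⟨fun h : ψ k ⬝ᵥ φ k = 0 => hne k ?_, h1⟩
  rw [h1, h, zero_smul]

/-- A matrix with simple spectrum supported on a connected graph has arbitrarily good
approximations whose eigenvectors vanish nowhere and refine the signs of the given ones. -/
lemma exists_perturbation {n : ℕ} {G : SimpleGraph (Fin n)} (hG : G.Connected)
    {A : Matrix (Fin n) (Fin n) ℝ} (hA : A.IsSymm) (hsupp : SupportedOn G A)
    {lam : Fin n → ℝ} {φ : Fin n → Fin n → ℝ} (hlam : StrictMono lam)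
    (heig : ∀ k, A.mulVec (φ k) = lam k • φ k) (hne : ∀ k, φ k ≠ 0) :
    ∃ (M : Matrix (Fin n) (Fin n) ℝ) (μ : Fin n → ℝ) (ψ : Fin n → Fin n → ℝ) (c : Fin n → ℝ),
      M.IsSymm ∧ SupportedOn G M ∧ (∀ i j, A i j ≠ 0 → 0 < A i j * M i j) ∧ StrictMono μ ∧
      (∀ k, M.mulVec (ψ k) = μ k • ψ k) ∧
      (∀ k m, ψ k ⬝ᵥ ψ m = if k = m then 1 else 0) ∧ (∀ k i, ψ k i ≠ 0) ∧
      (∀ k, c k ≠ 0) ∧ ∀ k i, φ k i ≠ 0 → 0 < c k * ψ k i * φ k i := by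
  obtain ⟨U, hU, hUA⟩ := mem_closure_iff_ultrafilter.mp
    (mem_closure_det_krylov_ne_zero hG Finset.univ hA hsupp)
  have hdata : ∀ M : Matrix (Fin n) (Fin n) ℝ, ∃ (μ : Fin n → ℝ) (ψ : Fin n → Fin n → ℝ),
      M.IsSymm → Monotone μ ∧ (∀ k, M.mulVec (ψ k) = μ k • ψ k) ∧
        ∀ k m, ψ k ⬝ᵥ ψ m = if k = m then 1 else 0 := by
    intro M
    by_cases hM : M.IsSymm
    · obtain ⟨μ, ψ, h⟩ := exists_sorted_orthonormal_eigenbasis hM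
      exact ⟨μ, ψ, fun _ => h⟩
    · exact ⟨0, 0, fun h => absurd h hM⟩
  choose μ ψ hμψ using hdata
  have hsymm : ∀ᶠ M : Matrix (Fin n) (Fin n) ℝ in (U : Filter _), M.IsSymm := by
    filter_upwards [hU] with M hM using hM.1
  have hcompact : IsCompact (Set.pi Set.univ fun _ : Fin n => Set.pi Set.univ
      fun _ : Fin n => Set.Icc (-1 : ℝ) 1) :=
    isCompact_univ_pi fun _ => isCompact_univ_pi fun _ => isCompact_Icc
  obtain ⟨ψ₀, -, hψ₀⟩ := hcompact.ultrafilter_le_nhds' (U.map ψ) (by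
    rw [Ultrafilter.mem_map]
    filter_upwards [hsymm] with M hM k _ i _
    have h1 := (hμψ M hM).2.2 k k
    rw [if_pos rfl, dotProduct] at h1
    have h2 := Finset.single_le_sum (f := fun i => ψ M k i * ψ M k i)
      (fun i _ => mul_self_nonneg _) (Finset.mem_univ i)
    exact abs_le.mp (abs_le_one_iff_mul_self_le_one.mpr (h2.trans h1.le)))
  have hψlim : Filter.Tendsto ψ U (nhds ψ₀) := hψ₀
  have hψlim' : ∀ k, Filter.Tendsto (fun M => ψ M k) U (nhds (ψ₀ k)) := fun k =>
    (tendsto_pi_nhds.mp hψlim) k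
  have hψlim'' : ∀ k i, Filter.Tendsto (fun M => ψ M k i) U (nhds (ψ₀ k i)) := fun k =>
    tendsto_pi_nhds.mp (hψlim' k)
  have hAlim : Filter.Tendsto (fun M : Matrix (Fin n) (Fin n) ℝ => M) U (nhds A) := hUA
  have hdot : ∀ {f g : Matrix (Fin n) (Fin n) ℝ → Fin n → ℝ} {a b : Fin n → ℝ},
      Filter.Tendsto f U (nhds a) → Filter.Tendsto g U (nhds b) →
      Filter.Tendsto (fun M => f M ⬝ᵥ g M) U (nhds (a ⬝ᵥ b)) := fun hf hg =>
    ((by fun_prop : Continuous fun p : (Fin n → ℝ) × (Fin n → ℝ) => p.1 ⬝ᵥ p.2).tendsto _).comp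
      (hf.prodMk_nhds hg)
  have hmul : ∀ k, Filter.Tendsto (fun M : Matrix (Fin n) (Fin n) ℝ => M.mulVec (ψ M k)) U
      (nhds (A.mulVec (ψ₀ k))) :=
    fun k => ((by fun_prop : Continuous fun p : Matrix (Fin n) (Fin n) ℝ × (Fin n → ℝ) =>
      p.1.mulVec p.2).tendsto _).comp (hAlim.prodMk_nhds (hψlim' k))
  have horth₀ : ∀ k m, ψ₀ k ⬝ᵥ ψ₀ m = if k = m then 1 else 0 := fun k m =>
    tendsto_nhds_unique (hdot (hψlim' k) (hψlim' m)) (tendsto_const_nhds.congr' (by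
      filter_upwards [hsymm] with M hM using ((hμψ M hM).2.2 k m).symm))
  let μ₀ : Fin n → ℝ := fun k => ψ₀ k ⬝ᵥ A.mulVec (ψ₀ k)
  have hμlim : ∀ k, Filter.Tendsto (fun M => μ M k) U (nhds (μ₀ k)) := fun k =>
    (hdot (hψlim' k) (hmul k)).congr' (by
      filter_upwards [hsymm] with M hM
      rw [(hμψ M hM).2.1, dotProduct_smul, (hμψ M hM).2.2, if_pos rfl, smul_eq_mul, mul_one])
  have heig₀ : ∀ k, A.mulVec (ψ₀ k) = μ₀ k • ψ₀ k := fun k =>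
    tendsto_nhds_unique (hmul k) (((hμlim k).smul (hψlim' k)).congr' (by
      filter_upwards [hsymm] with M hM using ((hμψ M hM).2.1 k).symm))
  have hμ₀ : Monotone μ₀ := fun k m hkm => le_of_tendsto_of_tendsto (hμlim k) (hμlim m) (by
    filter_upwards [hsymm] with M hM using (hμψ M hM).1 hkm)
  obtain ⟨hμ₀lam, c, hc⟩ := eigenbasis_unique hA hlam heig hne hμ₀ heig₀ horth₀
  have hstrict : ∀ᶠ M : Matrix (Fin n) (Fin n) ℝ in (U : Filter _),
      ∀ k m, k < m → μ M k < μ M m := by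
    simp only [Filter.eventually_all]
    exact fun k m hkm => (hμlim k).eventually_lt (hμlim m) (by rw [hμ₀lam]; exact hlam hkm)
  have hsign : ∀ᶠ M : Matrix (Fin n) (Fin n) ℝ in (U : Filter _),
      ∀ k i, φ k i ≠ 0 → 0 < c k * ψ M k i * φ k i := by
    simp only [Filter.eventually_all]
    intro k i hki
    refine (((hψlim'' k i).const_mul (c k)).mul_const (φ k i)).eventually_const_lt ?_
    have : φ k i = c k * ψ₀ k i := congrFun (hc k).2 i
    rw [← this]
    exact mul_self_pos.mpr hki
  have hedge : ∀ᶠ M : Matrix (Fin n) (Fin n) ℝ in (U : Filter _),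
      ∀ i j, A i j ≠ 0 → 0 < A i j * M i j := by
    simp only [Filter.eventually_all]
    intro i j hij
    have h1 : Filter.Tendsto (fun M : Matrix (Fin n) (Fin n) ℝ => M i j) U (nhds (A i j)) :=
      ((by fun_prop : Continuous fun M : Matrix (Fin n) (Fin n) ℝ => M i j).tendsto _).comp hAlim
    exact (h1.const_mul (A i j)).eventually_const_lt (mul_self_pos.mpr hij)
  have hmem : ∀ᶠ M : Matrix (Fin n) (Fin n) ℝ in (U : Filter _), M.IsSymm ∧ SupportedOn G M ∧
      ∀ z ∈ Finset.univ, (krylov M z).det ≠ 0 := hU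
  obtain ⟨M, ⟨hM, hMsupp, hMkry⟩, hM1, hM2, hM3⟩ :=
    (hmem.and (hstrict.and (hsign.and hedge))).exists
  obtain ⟨-, heigM, horthM⟩ := hμψ M hM
  refine ⟨M, μ M, ψ M, c, hM, hMsupp, hM3, fun k m => hM1 k m, heigM, horthM, fun k i => ?_,
    fun k => (hc k).1, hM2⟩
  refine eigenvector_apply_ne_zero (hMkry i (Finset.mem_univ i)) (μ := μ M k) ?_ ?_
  · rw [← heigM, ← Matrix.mulVec_transpose, hM.eq]
  · intro h
    have := horthM k k
    rw [h, if_pos rfl, zero_dotProduct] at this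
    exact zero_ne_one this

lemma card_edgeSet_eq_card_upperSupport {n : ℕ} {G : SimpleGraph (Fin n)}
    {M : Matrix (Fin n) (Fin n) ℝ} (hM : ∀ i j, i ≠ j → (M i j ≠ 0 ↔ G.Adj i j)) :
    Nat.card G.edgeSet = Fintype.card (UpperSupport M) := by
  rw [← Nat.card_eq_fintype_card]
  refine (Nat.card_congr (Equiv.ofBijective
    (fun p : UpperSupport M => (⟨s(p.1.1, p.1.2), (hM _ _ p.2.1.ne).mp p.2.2⟩ : G.edgeSet))
    ⟨?_, ?_⟩)).symm
  · rintro ⟨⟨a, b⟩, hab, _⟩ ⟨⟨a', b'⟩, hab', _⟩ h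
    rcases Sym2.eq_iff.mp (congrArg Subtype.val h) with ⟨rfl, rfl⟩ | ⟨rfl, rfl⟩
    · rfl
    · exact absurd hab hab'.not_gt
  · rintro ⟨e, he⟩
    induction e using Sym2.ind with
    | _ a b =>
      have hab : G.Adj a b := he
      rcases hab.ne.lt_or_gt with h | h
      · exact ⟨⟨(a, b), h, (hM _ _ h.ne).mpr hab⟩, rfl⟩
      · exact ⟨⟨(b, a), h, (hM _ _ h.ne).mpr hab.symm⟩, Subtype.ext Sym2.eq_swap⟩

lemma nodalCount_congr {n : ℕ} {A B : Matrix (Fin n) (Fin n) ℝ} {v w : Fin n → ℝ}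
    (h : ∀ i j, i < j → (0 < A i j * v i * v j ↔ 0 < B i j * w i * w j)) :
    nodalCount A v = nodalCount B w :=
  Nat.card_congr (Equiv.subtypeEquivRight fun _ => and_congr_right fun hp => h _ _ hp)

/-- if `A` is symmetric, strictly supported on a connected graph `G`, with
simple eigenvalues and eigenvectors `φ k` that may vanish at some entries, then there exist
sign vectors `ξ k ∈ {±1}ⁿ` agreeing with the signs of the nonzero entries of `φ k` whose
total nodal surplus satisfies the bounds `β(G) ≤ ∑ₖ [ν(A,ξₖ) - (k-1)] ≤ n·β(G) - β(G)`. -/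
theorem exists_signing_satisfying_bounds {n : ℕ}
    (G : SimpleGraph (Fin n)) (hG : G.Connected)
    (A : Matrix (Fin n) (Fin n) ℝ) (hA : A.IsSymm)
    (hsupp : SupportedOn G A) (hstrict : ∀ i j, G.Adj i j → A i j ≠ 0)
    (lam : Fin n → ℝ) (φ : Fin n → Fin n → ℝ) (hlam : StrictMono lam)
    (heig : ∀ k, A.mulVec (φ k) = lam k • φ k) (hne : ∀ k, φ k ≠ 0) :
    ∃ ξ : Fin n → Fin n → ℝ,
      (∀ k i, ξ k i = 1 ∨ ξ k i = -1) ∧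
      (∀ k i, φ k i ≠ 0 → 0 < ξ k i * φ k i) ∧
      (betti G : ℤ) ≤ ∑ k : Fin n, ((nodalCount A (ξ k) : ℤ) - ((k : ℕ) : ℤ)) ∧
      ∑ k : Fin n, ((nodalCount A (ξ k) : ℤ) - ((k : ℕ) : ℤ))
        ≤ (n : ℤ) * (betti G : ℤ) - (betti G : ℤ) := by
  have hn : 0 < n := Fin.pos_iff_nonempty.mpr hG.nonempty
  obtain ⟨M, μ, ψ, c, hM, hMsupp, hMA, hμ, hMeig, hMorth, hψ, hc, hsign⟩ :=
    exists_perturbation hG hA hsupp hlam heig hne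
  have hcψ : ∀ k i, c k * ψ k i ≠ 0 := fun k i => mul_ne_zero (hc k) (hψ k i)
  have hMadj : ∀ i j, i ≠ j → (M i j ≠ 0 ↔ G.Adj i j) := by
    refine fun i j hij => ⟨fun h => ?_, fun h => ?_⟩
    · by_contra hadj
      exact h (hMsupp i j hij hadj)
    · exact right_ne_zero_of_mul (hMA i j (hstrict i j h)).ne'
  let ξ : Fin n → Fin n → ℝ := fun k i => if 0 < c k * ψ k i then 1 else -1
  have hξ : ∀ k i, ξ k i * |c k * ψ k i| = c k * ψ k i := by
    intro k i
    rcases lt_or_gt_of_ne (hcψ k i) with h | h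
    · simp [ξ, h.not_gt, abs_of_neg h]
    · simp [ξ, h, abs_of_pos h]
  have hnodal : ∀ k, nodalCount A (ξ k) = nodalCount M (ψ k) := by
    refine fun k => nodalCount_congr fun i j hij => ?_
    by_cases hA0 : A i j = 0
    · have hM0 : M i j = 0 := hMsupp i j hij.ne fun h => hstrict i j h hA0
      simp [hA0, hM0]
    · have h1 := hMA i j hA0
      have hi := abs_pos.mpr (hcψ k i)
      have hj := abs_pos.mpr (hcψ k j)
      have hcc := mul_self_pos.mpr (hc k)
      have hξne : ∀ i, ξ k i ≠ 0 := fun i h => hcψ k i (by rw [← hξ k i, h, zero_mul])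
      have hξξ : 0 < (ξ k i * ξ k j) ^ 2 := by
        have := hξne i
        have := hξne j
        positivity
      have h2 : 0 < (A i j * ξ k i * ξ k j) * (M i j * ψ k i * ψ k j) := by
        refine pos_of_mul_pos_right (a := c k * c k) ?_ hcc.le
        calc 0 < (A i j * M i j) * (ξ k i * ξ k j) ^ 2 * (|c k * ψ k i| * |c k * ψ k j|) := by
              positivity
          _ = (A i j * M i j) * (ξ k i * ξ k j) * ((ξ k i * |c k * ψ k i|) *
              (ξ k j * |c k * ψ k j|)) := by ring
          _ = _ := by
              rw [hξ, hξ]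
              ring
      exact pos_iff_pos_of_mul_pos h2
  refine ⟨ξ, fun k i => ?_, fun k i hki => ?_, ?_⟩
  · by_cases h : 0 < c k * ψ k i <;> simp [ξ, h]
  · have h1 := hsign k i hki
    rw [← hξ, mul_right_comm] at h1
    exact pos_of_mul_pos_left h1 (abs_nonneg _)
  · have hlow := card_edges_add_sum_le hM hμ hMeig hMorth hψ hn
    have hupp := sum_nodalCount_add_sum_le hM hμ hMeig hMorth hψ hn
    have hE := card_edgeSet_eq_card_upperSupport hMadj
    have htree := hG.card_vert_le_card_edgeSet_add_one
    rw [Nat.card_fin] at htree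
    have hb : (betti G : ℤ) = Fintype.card (UpperSupport M) - (n - 1) := by
      rw [betti, hE]
      omega
    have hgauss : (∑ k : Fin n, (k : ℤ)) * 2 = n * (n - 1) := by
      have := Finset.sum_range_id_mul_two n
      rw [← Fin.sum_univ_eq_sum_range (fun i => i)] at this
      zify [hn] at this
      simpa using this
    simp only [hnodal, Finset.sum_sub_distrib, hb]
    zify [hn] at hlow hupp
    constructor
    · linarith
    · linarith
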